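/- Let X and Y be disjoint posets whose join X * Y is an n-PCM with n ≥ 0. If X is a k-surface with k ≥ 0, then Y is an (n − k − 1)-PCM; symmetrically, if Y is an ℓ-surface with ℓ ≥ 0, then X is an (n − ℓ − 1)-PCM. -/

import Mathlib

namespace PCMPaper

variable {α : Type*} [PartialOrder α]

/-- The set of elements of `X` strictly below `h` (α□_X(h)). -/
def alphaS (X : Set α) (h : α) : Set α := {x ∈ X | x < h}

/-- The set of elements of `X` strictly above `h` (β□_X(h)). -/
def betaS (X : Set α) (h : α) : Set α := {x ∈ X | h < x}

/-- The (strict) neighborhood θ□_X(h) = α□_X(h) ∪ β□_X(h). -/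
def thetaS (X : Set α) (h : α) : Set α := alphaS X h ∪ betaS X h

/-- The rank of `h` in the poset `X`: the maximal length of a strictly increasing
chain in `X` ending at `h`.  (It equals 0 when α□_X(h) = ∅ and
`max_{x ∈ α□_X(h)} rank X x + 1` otherwise, for finite `X`.) -/
noncomputable def rank (X : Set α) (h : α) : ℕ :=
  sSup {n : ℕ | ∃ c : Fin (n + 1) → α, StrictMono c ∧ (∀ i, c i ∈ X) ∧ c (Fin.last n) = h}

open scoped Classical in
/-- The rank of the poset `X`: maximal rank of its elements, `-1` if empty. -/
noncomputable def rankSet (X : Set α) : ℤ :=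
  if X = ∅ then -1 else ((sSup (rank X '' X) : ℕ) : ℤ)

/-- One step of a path in `X`: two distinct comparable elements of `X`. -/
def rel (X : Set α) (x y : α) : Prop :=
  x ∈ X ∧ y ∈ X ∧ x ≠ y ∧ (x < y ∨ y < x)

/-- `X` is (path-)connected: any two elements are joined by a path in `X`. -/
def IsConnected (X : Set α) : Prop :=
  ∀ x ∈ X, ∀ y ∈ X, Relation.ReflTransGen (rel X) x y

/-- `IsSurfaceAux (k + 1) X` means that `X` is a (discrete) `k`-surface. -/
def IsSurfaceAux : ℕ → Set α → Prop
  | 0, X => X = ∅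
  | 1, X => ∃ x y : α, x ≠ y ∧ ¬ x < y ∧ ¬ y < x ∧ X = {x, y}
  | (n + 2), X => X.Nonempty ∧ IsConnected X ∧ ∀ h ∈ X, IsSurfaceAux (n + 1) (thetaS X h)

/-- `X` is a discrete `k`-surface (`k : ℤ`, `k ≥ -1`). -/
def IsSurface (k : ℤ) (X : Set α) : Prop :=
  ∃ n : ℕ, (n : ℤ) = k + 1 ∧ IsSurfaceAux n X

/-- The border ΔX of a poset `X` of rank `n`:
elements whose neighborhood is not an `(n-1)`-surface. -/
def border (X : Set α) : Set α :=
  {h ∈ X | ¬ IsSurface (rankSet X - 1) (thetaS X h)}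

/-- The interior of `X`. -/
def interior' (X : Set α) : Set α := X \ border X

/-- `IsPCMAux (n + 1) X` means that `X` is an `n`-PCM. -/
def IsPCMAux : ℕ → Set α → Prop
  | 0, X => X = ∅
  | 1, X => ∃ x : α, X = {x}
  | (n + 2), X => rankSet X = ((n : ℤ) + 1) ∧ IsConnected X ∧ border X ≠ ∅ ∧
      ∀ h ∈ X, (h ∈ border X → IsPCMAux (n + 1) (thetaS X h)) ∧
               (h ∉ border X → IsSurfaceAux (n + 1) (thetaS X h))

/-- `X` is an `k`-PCM (`k : ℤ`, `k ≥ -1`). -/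
def IsPCM (k : ℤ) (X : Set α) : Prop :=
  ∃ n : ℕ, (n : ℤ) = k + 1 ∧ IsPCMAux n X

/-- Fuel-indexed coherence. -/
def IsCoherentAux : ℕ → Set α → Prop
  | 0, X => X = ∅
  | (n + 1), X => X = ∅ ∨
      ∀ h ∈ X, rankSet (thetaS X h) = rankSet X - 1 ∧ IsCoherentAux n (thetaS X h)

/-- `X` is a coherent poset. -/
def IsCoherent (X : Set α) : Prop := ∃ n : ℕ, IsCoherentAux n X

/-- `X` is a separated union of `(m-1)`-surfaces: a union of `(m-1)`-surfaces such
that no element of one of them is comparable to an element of another one. -/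
def IsSeparatedUnionOfSurfacesAux (m : ℕ) (X : Set α) : Prop :=
  ∃ P : Set (Set α), P.Nonempty ∧ X = ⋃₀ P ∧ (∀ S ∈ P, IsSurfaceAux m S) ∧
    ∀ S ∈ P, ∀ T ∈ P, S ≠ T → ∀ x ∈ S, ∀ y ∈ T, ¬ x ≤ y ∧ ¬ y ≤ x

/-- `IsSmoothPCMAux (n + 1) X` means that `X` is a smooth `n`-PCM. -/
def IsSmoothPCMAux : ℕ → Set α → Prop
  | 0, X => X = ∅
  | 1, X => ∃ x : α, X = {x}
  | (n + 2), X => rankSet X = ((n : ℤ) + 1) ∧ IsConnected X ∧ border X ≠ ∅ ∧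
      IsSeparatedUnionOfSurfacesAux (n + 1) (border X) ∧
      ∀ h ∈ X, IsSurfaceAux (n + 1) (thetaS X h) ∨ IsSmoothPCMAux (n + 1) (thetaS X h)

/-- `X` is a smooth `k`-PCM (`k : ℤ`, `k ≥ -1`). -/
def IsSmoothPCM (k : ℤ) (X : Set α) : Prop :=
  ∃ n : ℕ, (n : ℤ) = k + 1 ∧ IsSmoothPCMAux n X

/-- A simplicial complex: a finite family of nonempty finite sets, closed under
taking nonempty subsets and under nonempty intersections. -/
def IsSimplicialComplex {V : Type*} [DecidableEq V] (X : Set (Finset V)) : Prop :=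
  X.Finite ∧ (∀ h ∈ X, h.Nonempty) ∧
  (∀ h ∈ X, ∀ h' : Finset V, h'.Nonempty → h' ⊆ h → h' ∈ X) ∧
  (∀ h ∈ X, ∀ h' ∈ X, (h ∩ h').Nonempty → h ∩ h' ∈ X)

/-- The dimension of a simplex. -/
def dim {V : Type*} (h : Finset V) : ℤ := (h.card : ℤ) - 1

/-- The link of a simplex `h` in a family of simplices `S`. -/
def link {V : Type*} [DecidableEq V] (h : Finset V) (S : Set (Finset V)) : Set (Finset V) :=
  {h' ∈ S | h ∩ h' = ∅ ∧ h ∪ h' ∈ S}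

/-- `X` is pure of rank `n`: every simplex is contained in an `n`-dimensional one. -/
def Pure {V : Type*} (X : Set (Finset V)) (n : ℤ) : Prop :=
  ∀ h ∈ X, ∃ g ∈ X, h ⊆ g ∧ dim g = n

/-- Any two `n`-simplices of `X` are joined by a path in `X` all of whose elements
are simplices of dimension `n - 1` or `n` (i.e. `X` is `(n-1)`-connected). -/
def NConnected {V : Type*} (X : Set (Finset V)) (n : ℤ) : Prop :=
  ∀ a ∈ X, dim a = n → ∀ b ∈ X, dim b = n →
    Relation.ReflTransGen (rel {h | h ∈ X ∧ (dim h = n - 1 ∨ dim h = n)}) a b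

/-- `X` is a pseudomanifold of rank `n`. -/
def IsPseudomanifold {V : Type*} [DecidableEq V] (X : Set (Finset V)) (n : ℤ) : Prop :=
  IsSimplicialComplex X ∧ rankSet X = n ∧
  ((n = 0 ∧ ∃ v : V, X = {({v} : Finset V)}) ∨
   (1 ≤ n ∧ Pure X n ∧
    (∀ h ∈ X, dim h = n - 1 →
      Set.ncard {g | g ∈ X ∧ h ⊆ g ∧ dim g = n} ∈ ({1, 2} : Set ℕ)) ∧
    NConnected X n))

/-- `X` is a normal pseudomanifold of rank `n`: a pseudomanifold such that the link
of every simplex of dimension at most `n - 2` is a pseudomanifold. -/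
def IsNormalPseudomanifold {V : Type*} [DecidableEq V] (X : Set (Finset V)) (n : ℤ) : Prop :=
  IsPseudomanifold X n ∧
  ∀ h ∈ X, dim h ≤ n - 2 → IsPseudomanifold (link h X) (n - dim h - 1)


theorem thetaS_union_left {X Y : Set α} (hc : ∀ x ∈ X, ∀ y ∈ Y, x < y ∨ y < x) {x : α}
    (hx : x ∈ X) : thetaS (X ∪ Y) x = thetaS X x ∪ Y := by
  ext z
  have := hc x hx z
  simp only [thetaS, alphaS, betaS, Set.mem_union, Set.mem_ofPred_eq]
  tauto

theorem mem_of_mem_thetaS {X : Set α} {x z : α} (hz : z ∈ thetaS X x) : z ∈ X := by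
  rcases hz with hz | hz <;> exact hz.1

theorem IsSurfaceAux.nonempty {p : ℕ} {X : Set α} (h : IsSurfaceAux (p + 1) X) :
    X.Nonempty := by
  cases p with
  | zero =>
    obtain ⟨x, y, -, -, -, rfl⟩ := h
    exact ⟨x, by simp⟩
  | succ p => exact h.1

theorem IsSurfaceAux.thetaS {p : ℕ} {X : Set α} (h : IsSurfaceAux (p + 1) X) {x : α}
    (hx : x ∈ X) : IsSurfaceAux p (thetaS X x) := by
  cases p with
  | zero =>
    obtain ⟨a, b, hab, h1, h2, rfl⟩ := h
    refine Set.eq_empty_iff_forall_notMem.2 fun z hz => ?_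
    simp only [PCMPaper.thetaS, alphaS, betaS, Set.mem_union, Set.mem_ofPred_eq,
      Set.mem_insert_iff, Set.mem_singleton_iff] at hz hx
    rcases hx with rfl | rfl <;> rcases hz with ⟨rfl | rfl, hz⟩ | ⟨rfl | rfl, hz⟩ <;>
      simp_all
  | succ p => exact h.2.2 x hx

theorem isConnected_union {X Y : Set α} (hc : ∀ x ∈ X, ∀ y ∈ Y, x < y ∨ y < x)
    (hX : X.Nonempty) (hY : Y.Nonempty) : IsConnected (X ∪ Y) := by
  have step : ∀ x ∈ X, ∀ y ∈ Y, rel (X ∪ Y) x y ∧ rel (X ∪ Y) y x := by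
    intro x hx y hy
    have h := hc x hx y hy
    have hne : x ≠ y := by
      rintro rfl
      simp at h
    exact ⟨⟨.inl hx, .inr hy, hne, h⟩, ⟨.inr hy, .inl hx, hne.symm, h.symm⟩⟩
  obtain ⟨x₀, hx₀⟩ := hX
  obtain ⟨y₀, hy₀⟩ := hY
  rintro a (ha | ha) b (hb | hb)
  · exact .head (step a ha y₀ hy₀).1 (.single (step b hb y₀ hy₀).2)
  · exact .single (step a ha b hb).1
  · exact .single (step b hb a ha).2
  · exact .head (step x₀ hx₀ a ha).2 (.single (step x₀ hx₀ b hb).1)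

/-- The join of two surfaces is a surface. -/
theorem IsSurfaceAux.union {p q : ℕ} {X Y : Set α}
    (hc : ∀ x ∈ X, ∀ y ∈ Y, x < y ∨ y < x) (hX : IsSurfaceAux p X) (hY : IsSurfaceAux q Y) :
    IsSurfaceAux (p + q) (X ∪ Y) := by
  induction p generalizing q X Y with
  | zero =>
    obtain rfl : X = ∅ := hX
    simpa using hY
  | succ p ihp =>
    induction q generalizing Y with
    | zero =>
      obtain rfl : Y = ∅ := hY
      simpa using hX
    | succ q ihq =>
      have e : p + 1 + (q + 1) = (p + q) + 2 := by omega
      rw [e]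
      refine ⟨hX.nonempty.mono Set.subset_union_left,
        isConnected_union hc hX.nonempty hY.nonempty, ?_⟩
      rintro h (hh | hh)
      · rw [thetaS_union_left hc hh]
        exact ihp (fun x hx => hc x (mem_of_mem_thetaS hx)) (hX.thetaS hh) hY
      · rw [Set.union_comm, thetaS_union_left (fun y hy x hx => (hc x hx y hy).symm) hh,
          Set.union_comm, show p + q + 1 = p + 1 + q by omega]
        exact ihq (fun x hx y hy => hc x hx y (mem_of_mem_thetaS hy)) (hY.thetaS hh)

/-- If a join and one of its factors are surfaces, so is the other factor. -/
theorem IsSurfaceAux.of_union {p q : ℕ} {X Y : Set α}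
    (hc : ∀ x ∈ X, ∀ y ∈ Y, x < y ∨ y < x) (hX : IsSurfaceAux p X)
    (h : IsSurfaceAux q (X ∪ Y)) : ∃ r, q = p + r ∧ IsSurfaceAux r Y := by
  induction p generalizing q X with
  | zero =>
    obtain rfl : X = ∅ := hX
    exact ⟨q, by simp, by simpa using h⟩
  | succ p ih =>
    obtain ⟨x, hx⟩ := hX.nonempty
    cases q with
    | zero =>
      have h' : X ∪ Y = ∅ := h
      exact absurd (h' ▸ Set.mem_union_left Y hx : x ∈ (∅ : Set α)) (Set.notMem_empty x)
    | succ q =>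
      have ht := h.thetaS (Set.mem_union_left Y hx)
      rw [thetaS_union_left hc hx] at ht
      obtain ⟨r, rfl, hr⟩ := ih (fun z hz => hc z (mem_of_mem_thetaS hz)) (hX.thetaS hx) ht
      exact ⟨r, by omega, hr⟩

theorem IsSurfaceAux.not_subset_singleton {p : ℕ} {X : Set α} (h : IsSurfaceAux (p + 1) X)
    (z : α) : ¬ X ⊆ {z} := by
  intro hz
  have hsing : X = {z} := (Set.Nonempty.subset_singleton_iff h.nonempty).1 hz
  subst hsing
  cases p with
  | zero =>
    obtain ⟨a, b, hab, -, -, hX⟩ := h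
    have ha : a ∈ ({z} : Set α) := hX ▸ by simp
    have hb : b ∈ ({z} : Set α) := hX ▸ by simp
    exact hab (ha.trans hb.symm)
  | succ p =>
    obtain ⟨w, hw⟩ := (h.thetaS (Set.mem_singleton z)).nonempty
    have hwz : w = z := Set.mem_singleton_iff.1 (mem_of_mem_thetaS hw)
    subst hwz
    simp [PCMPaper.thetaS, alphaS, betaS] at hw

theorem IsSurfaceAux.border_eq_empty {n : ℕ} {X : Set α} (h : IsSurfaceAux (n + 1) X)
    (hr : rankSet X = n) : border X = ∅ :=
  Set.eq_empty_iff_forall_notMem.2 fun _ hx => hx.2 ⟨n, by omega, h.thetaS hx.1⟩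

/-- If a join is a PCM and one of its factors is a surface, the other factor is a PCM. -/
theorem IsPCMAux.of_union {p q : ℕ} {X Y : Set α}
    (hc : ∀ x ∈ X, ∀ y ∈ Y, x < y ∨ y < x) (hX : IsSurfaceAux p X)
    (h : IsPCMAux q (X ∪ Y)) : ∃ r, q = p + r ∧ IsPCMAux r Y := by
  induction p generalizing q X with
  | zero =>
    obtain rfl : X = ∅ := hX
    exact ⟨q, by simp, by simpa using h⟩
  | succ p ih =>
    obtain ⟨x, hx⟩ := hX.nonempty
    match q, h with
    | 0, h =>
      have h' : X ∪ Y = ∅ := h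
      exact absurd (h' ▸ Set.mem_union_left Y hx : x ∈ (∅ : Set α)) (Set.notMem_empty x)
    | 1, h =>
      obtain ⟨z, hz⟩ := h
      exact absurd (hz ▸ Set.subset_union_left) (hX.not_subset_singleton z)
    | q + 2, h =>
      obtain ⟨hrank, -, hborder, hθ⟩ := h
      have hθx := hθ x (Set.mem_union_left Y hx)
      have hc' : ∀ z ∈ PCMPaper.thetaS X x, ∀ y ∈ Y, z < y ∨ y < z :=
        fun z hz => hc z (mem_of_mem_thetaS hz)
      rw [thetaS_union_left hc hx] at hθx
      by_cases hxb : x ∈ border (X ∪ Y)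
      · obtain ⟨r, hqr, hr⟩ := ih hc' (hX.thetaS hx) (hθx.1 hxb)
        exact ⟨r, by omega, hr⟩
      · obtain ⟨r, hqr, hr⟩ := IsSurfaceAux.of_union hc' (hX.thetaS hx) (hθx.2 hxb)
        have hs := hX.union hc hr
        rw [show p + 1 + r = q + 1 + 1 by omega] at hs
        exact absurd (hs.border_eq_empty (by rw [hrank]; push_cast; rfl)) hborder

theorem IsPCM.of_union {k n : ℤ} {X Y : Set α}
    (hc : ∀ x ∈ X, ∀ y ∈ Y, x < y ∨ y < x) (hX : IsSurface k X)
    (h : IsPCM n (X ∪ Y)) : IsPCM (n - k - 1) Y := by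
  obtain ⟨p, hp, hX⟩ := hX
  obtain ⟨q, hq, h⟩ := h
  obtain ⟨r, hr, hY⟩ := h.of_union hc hX
  exact ⟨r, by omega, hY⟩

/-- Let `X` and `Y` be disjoint (finite) posets whose join `X * Y`
(realized here as `X ∪ Y` where every element of `X` is below every element of `Y`)
is an `n`-PCM with `n ≥ 0`.  If `X` is a `k`-surface with `k ≥ 0` then `Y` is an
`(n - k - 1)`-PCM; symmetrically, if `Y` is an `l`-surface with `l ≥ 0` then `X`
is an `(n - l - 1)`-PCM. -/
theorem statement_11 {α : Type*} [PartialOrder α] (X Y : Set α)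
    (hfX : X.Finite) (hfY : Y.Finite) (hdisj : Disjoint X Y)
    (hjoin : ∀ x ∈ X, ∀ y ∈ Y, x < y)
    (n : ℤ) (hn : 0 ≤ n) (hpcm : IsPCM n (X ∪ Y)) :
    (∀ k : ℤ, 0 ≤ k → IsSurface k X → IsPCM (n - k - 1) Y) ∧
    (∀ l : ℤ, 0 ≤ l → IsSurface l Y → IsPCM (n - l - 1) X) := by
  refine ⟨fun k _ hX => hpcm.of_union (fun x hx y hy => .inl (hjoin x hx y hy)) hX,
    fun l _ hY => ?_⟩
  rw [Set.union_comm] at hpcm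
  exact hpcm.of_union (fun y hy x hx => .inr (hjoin x hx y hy)) hY

end PCMPaper
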